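/- Let 𝔏 be a finitely generated complex Lie algebra and let V be an 𝔏-module such that the action of 𝔏 on V is locally nilpotent (for every v ∈ V there exists n ∈ ℤ₊ with 𝔏ⁿ·v = 0). Then the action of 𝔏 on V is locally finite (for every v ∈ V the space ∑_{n∈ℤ₊} 𝔏ⁿ·v is finite-dimensional). -/

import Mathlib

noncomputable section

section LocalFiniteness

variable {K W : Type} [LieRing K] [LieAlgebra ℂ K] [AddCommGroup W] [Module ℂ W]
  [LieRingModule K W]

/-- The action of `x` on `W` is locally nilpotent. -/
def locNilpotentAct (x : K) : Prop :=
  ∀ w : W, ∃ n : ℕ, 0 < n ∧ (fun u : W => ⁅x, u⁆)^[n] w = 0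

/-- The action of `x` on `W` is locally finite: for every `w` the span of all
`xⁿ·w`, `n ∈ ℕ`, is finite-dimensional. -/
def locFiniteAct (x : K) : Prop :=
  ∀ w : W, FiniteDimensional ℂ
    (Submodule.span ℂ (Set.range fun n : ℕ => ((fun u : W => ⁅x, u⁆)^[n]) w))

/-- The set of vectors obtained from `v` by applying `n` elements of `H ⊆ K`. -/
def brSet (H : Set K) (v : W) : ℕ → Set W
  | 0 => {v}
  | n + 1 => {w | ∃ x ∈ H, ∃ u ∈ brSet H v n, w = ⁅x, u⁆}

/-- The action of the subset `H ⊆ K` on `W` is locally finite: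
`∑_{n ≥ 1} Hⁿ·v` is finite-dimensional for every `v`. -/
def locFiniteSetAct (H : Set K) : Prop :=
  ∀ v : W, FiniteDimensional ℂ (Submodule.span ℂ (⋃ n : ℕ, brSet H v (n + 1)))

/-- The action of the subset `H ⊆ K` on `W` is locally nilpotent:
for every `v` there is `n ≥ 1` with `Hⁿ·v = 0`. -/
def locNilpotentSetAct (H : Set K) : Prop :=
  ∀ v : W, ∃ n : ℕ, 0 < n ∧ ∀ w ∈ brSet H v n, w = 0

end LocalFiniteness

section BrSet

variable {K W : Type} [LieRing K] [AddCommGroup W] [LieRingModule K W]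

theorem brSet_mono {H H' : Set K} (h : H ⊆ H') (v : W) (n : ℕ) : brSet H v n ⊆ brSet H' v n := by
  induction n with
  | zero => exact subset_rfl
  | succ n ih =>
    rintro w ⟨x, hx, u, hu, rfl⟩
    exact ⟨x, h hx, u, ih hu, rfl⟩

theorem finite_brSet {H : Set K} (hH : H.Finite) (v : W) (n : ℕ) : (brSet H v n).Finite := by
  induction n with
  | zero => exact Set.finite_singleton v
  | succ n ih =>
    refine (hH.image2 (fun x u => ⁅x, u⁆) ih).subset ?_
    rintro w ⟨x, hx, u, hu, rfl⟩
    exact ⟨x, hx, u, hu, rfl⟩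

variable [Module ℂ W]

theorem brSet_subset {H : Set K} {v : W} {P : Submodule ℂ W} (hv : v ∈ P)
    (hP : ∀ x ∈ H, ∀ w ∈ P, ⁅x, w⁆ ∈ P) (n : ℕ) : brSet H v n ⊆ P := by
  induction n with
  | zero => rintro w rfl; exact hv
  | succ n ih =>
    rintro w ⟨x, hx, u, hu, rfl⟩
    exact hP x hx u (ih hu)

variable [LieAlgebra ℂ K] [LieModule ℂ K W]

/-- A subspace stable under a set of elements is stable under the Lie subalgebra they generate. -/
theorem lie_mem_of_mem_lieSpan {H : Set K} {P : Submodule ℂ W}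
    (hP : ∀ x ∈ H, ∀ w ∈ P, ⁅x, w⁆ ∈ P) {x : K} (hx : x ∈ LieSubalgebra.lieSpan ℂ K H) :
    ∀ w ∈ P, ⁅x, w⁆ ∈ P := by
  induction hx using LieSubalgebra.lieSpan_induction with
  | mem x hx => exact hP x hx
  | zero => intro w _; simp
  | add x y _ _ hx hy => intro w hw; rw [add_lie]; exact P.add_mem (hx w hw) (hy w hw)
  | smul c x _ hx => intro w hw; rw [smul_lie]; exact P.smul_mem c (hx w hw)
  | lie x y _ _ hx hy =>
    intro w hw
    rw [lie_lie]
    exact P.sub_mem (hx _ (hy w hw)) (hy _ (hx w hw))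

/-- If `Hⁿ·v = 0`, the span of the vectors `Hᵏ·v` with `k < n` is stable under `H`. -/
theorem lie_mem_span_iUnion_brSet {H : Set K} {v : W} {n : ℕ}
    (hn : ∀ w ∈ brSet H v n, w = 0) {x : K} (hx : x ∈ H) {w : W}
    (hw : w ∈ Submodule.span ℂ (⋃ k ∈ Set.Iio n, brSet H v k)) :
    ⁅x, w⁆ ∈ Submodule.span ℂ (⋃ k ∈ Set.Iio n, brSet H v k) := by
  induction hw using Submodule.span_induction with
  | zero => simp
  | add a b _ _ ha hb => rw [lie_add]; exact add_mem ha hb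
  | smul c a _ ha => rw [lie_smul]; exact Submodule.smul_mem _ c ha
  | mem a ha =>
    obtain ⟨k, hk, ha⟩ := Set.mem_iUnion₂.1 ha
    have hxa : ⁅x, a⁆ ∈ brSet H v (k + 1) := ⟨x, hx, a, ha, rfl⟩
    obtain hlt | rfl := (Nat.succ_le_of_lt hk).lt_or_eq
    · exact Submodule.subset_span (Set.mem_iUnion₂.2 ⟨k + 1, hlt, hxa⟩)
    · rw [hn _ hxa]; exact zero_mem _

end BrSet

/-- For a finitely generated complex Lie algebra, a locally nilpotent action on a module
is locally finite. -/
theorem lie_finitelyGenerated_locallyNilpotent_locallyFinite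
    (L : Type) [LieRing L] [LieAlgebra ℂ L]
    (hfg : ∃ s : Finset L, LieSubalgebra.lieSpan ℂ L (s : Set L) = ⊤)
    (V : Type) [AddCommGroup V] [Module ℂ V] [LieRingModule L V] [LieModule ℂ L V]
    (hnil : locNilpotentSetAct (W := V) (Set.univ : Set L)) :
    locFiniteSetAct (W := V) (Set.univ : Set L) := by
  intro v
  obtain ⟨s, hs⟩ := hfg
  obtain ⟨n, hpos, hn⟩ := hnil v
  let P : Submodule ℂ V := Submodule.span ℂ (⋃ k ∈ Set.Iio n, brSet (s : Set L) v k)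
  have hfin : FiniteDimensional ℂ P := FiniteDimensional.span_of_finite ℂ
    ((Set.finite_Iio n).biUnion fun k _ => finite_brSet s.finite_toSet v k)
  have hv : v ∈ P := Submodule.subset_span (Set.mem_iUnion₂.2 ⟨0, hpos, rfl⟩)
  have hstable : ∀ x ∈ (Set.univ : Set L), ∀ w ∈ P, ⁅x, w⁆ ∈ P := fun x _ =>
    lie_mem_of_mem_lieSpan (H := (s : Set L))
      (fun y hy w hw => lie_mem_span_iUnion_brSet
        (fun u hu => hn u (brSet_mono (Set.subset_univ _) v n hu)) hy hw)
      (hs ▸ LieSubalgebra.mem_top x)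
  have hle : Submodule.span ℂ (⋃ k : ℕ, brSet (Set.univ : Set L) v (k + 1)) ≤ P :=
    Submodule.span_le.2 (Set.iUnion_subset fun k => brSet_subset hv hstable (k + 1))
  exact Submodule.finiteDimensional_of_le hle
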